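/- arXiv:1507.06115 — 3 statements merged into one kernel-verified Lean document; each statement's English description precedes it below -/
import Mathlib

section
/- Let δ ∈ (0,1), let s ≥ 1 be a natural number, and let g : ℝ → ℝ and a_0, …, a_s ∈ ℝ satisfy g(λ) = ∑_{r=0}^{s} a_r λ^r + o(λ^s) as λ → 0⁺. Then the first-order extrapolation g¹(λ) := (g(δλ) − δ g(λ))/(1 − δ) satisfies g¹(λ) = a_0 + (δ/(1−δ)) ∑_{r=2}^{s} (δ^{r−1} − 1) a_r λ^r + o(λ^s) as λ → 0⁺; in particular the first-order term a_1 λ is eliminated while the constant term a_0 is preserved. -/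
open Filter Topology Asymptotics Finset

/-- The extrapolation of a polynomial of degree at most `s` in closed form. -/
theorem sum_range_extrapolation (δ : ℝ) (hδ : δ ≠ 1) (s : ℕ) (hs : 1 ≤ s) (a : ℕ → ℝ) (x : ℝ) :
    (∑ r ∈ range (s + 1), a r * (δ * x) ^ r - δ * ∑ r ∈ range (s + 1), a r * x ^ r) / (1 - δ)
      = a 0 + (δ / (1 - δ)) * ∑ r ∈ Icc 2 s, (δ ^ (r - 1) - 1) * a r * x ^ r := by
  have h : 1 - δ ≠ 0 := sub_ne_zero.mpr hδ.symm
  induction s, hs using Nat.le_induction with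
  | base =>
    simp [sum_range_succ]
    field_simp
    ring
  | succ n hn ih =>
    rw [sum_range_succ _ (n + 1), sum_range_succ _ (n + 1), sum_Icc_succ_top (by omega),
      mul_add (δ / (1 - δ)), ← add_assoc, ← ih, Nat.add_sub_cancel]
    field_simp
    ring

/-- First-order Richardson extrapolation: if `g(λ) = ∑_{r=0}^s a_r λ^r + o(λ^s)` as `λ → 0⁺`
with `s ≥ 1`, then `g¹(λ) := (g(δλ) − δ g(λ))/(1 − δ)` satisfies
`g¹(λ) = a_0 + (δ/(1−δ)) ∑_{r=2}^s (δ^{r−1} − 1) a_r λ^r + o(λ^s)` as `λ → 0⁺`. -/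
theorem first_order_extrapolation (δ : ℝ) (hδ0 : 0 < δ) (hδ1 : δ < 1) (s : ℕ) (hs : 1 ≤ s)
    (g : ℝ → ℝ) (a : ℕ → ℝ)
    (hg : (fun lam : ℝ => g lam - ∑ r ∈ range (s + 1), a r * lam ^ r)
      =o[𝓝[>] (0 : ℝ)] (fun lam : ℝ => lam ^ s)) :
    (fun lam : ℝ => (g (δ * lam) - δ * g lam) / (1 - δ)
        - (a 0 + (δ / (1 - δ)) * ∑ r ∈ Icc 2 s, (δ ^ (r - 1) - 1) * a r * lam ^ r))
      =o[𝓝[>] (0 : ℝ)] (fun lam : ℝ => lam ^ s) := by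
  have hmaps : Tendsto (fun lam : ℝ => δ * lam) (𝓝[>] 0) (𝓝[>] 0) := by
    refine tendsto_nhdsWithin_iff.mpr ⟨?_, ?_⟩
    · have : Tendsto (fun lam : ℝ => δ * lam) (𝓝 0) (𝓝 (δ * 0)) :=
        (continuous_const.mul continuous_id).tendsto 0
      rw [mul_zero] at this
      exact this.mono_left nhdsWithin_le_nhds
    · filter_upwards [self_mem_nhdsWithin] with lam hlam
      exact mul_pos hδ0 hlam
  have hscaled := hg.comp_tendsto hmaps
  simp only [Function.comp_def, mul_pow δ _ s] at hscaled
  have hcomb := ((hscaled.of_const_mul_right).sub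
    (hg.const_mul_left δ)).const_mul_left (1 - δ)⁻¹
  refine hcomb.congr_left fun lam => ?_
  rw [← sum_range_extrapolation δ hδ1.ne s hs a lam]
  ring
end

section
/- Let K : ℝ → ℝ satisfy K(x) → 0 as x → −∞ and K(x) → 1 as x → +∞. Let T ∈ ℕ and let v_{t,0}, v_{t,1} ∈ ℝ for t = 1, …, T, all nonzero. Define the unsmoothed choices by y_0 := 0 and y_t := 1{v_{t,0} > 0}·(1 − y_{t−1}) + 1{v_{t,1} > 0}·y_{t−1} for t = 1,…,T, and for each λ > 0 define the smoothed choices by y_0(λ) := 0 and y_t(λ) := K(v_{t,0}/λ)·(1 − y_{t−1}(λ)) + K(v_{t,1}/λ)·y_{t−1}(λ) for t = 1,…,T. Then for every t ∈ {0,1,…,T}, y_t(λ) → y_t as λ → 0⁺. -/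
open Filter Topology

/-- A kernel of distribution-function type, rescaled by a bandwidth tending to `0⁺`, converges
to the indicator of positivity at every nonzero point. -/
theorem tendsto_comp_div_nhdsGT_zero {K : ℝ → ℝ} (hK0 : Tendsto K atBot (𝓝 0))
    (hK1 : Tendsto K atTop (𝓝 1)) {v : ℝ} (hv : v ≠ 0) :
    Tendsto (fun lam : ℝ => K (v / lam)) (𝓝[>] 0) (𝓝 (if 0 < v then 1 else 0)) := by
  simp only [div_eq_mul_inv]
  rcases hv.lt_or_gt with h | h
  · rw [if_neg h.not_gt]
    exact hK0.comp (tendsto_inv_nhdsGT_zero.const_mul_atTop_of_neg h)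
  · rw [if_pos h]
    exact hK1.comp (tendsto_inv_nhdsGT_zero.const_mul_atTop h)

/-- The smoothed dynamic-choice recursion converges to the unsmoothed one: with
`y_0 = 0`, `y_t = 1{v_{t,0} > 0}(1 − y_{t−1}) + 1{v_{t,1} > 0} y_{t−1}`, and for `λ > 0`,
`y_0(λ) = 0`, `y_t(λ) = K(v_{t,0}/λ)(1 − y_{t−1}(λ)) + K(v_{t,1}/λ) y_{t−1}(λ)`,
one has `y_t(λ) → y_t` as `λ → 0⁺`, for every `t ≤ T`, provided `K(x) → 0` as `x → −∞`,
`K(x) → 1` as `x → +∞`, and all the `v_{t,j}` are nonzero. -/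
theorem smoothed_dynamic_recursion_tendsto (K : ℝ → ℝ)
    (hK0 : Filter.Tendsto K atBot (𝓝 0)) (hK1 : Filter.Tendsto K atTop (𝓝 1))
    (T : ℕ) (v0 v1 : ℕ → ℝ)
    (hv0 : ∀ t, 1 ≤ t → t ≤ T → v0 t ≠ 0) (hv1 : ∀ t, 1 ≤ t → t ≤ T → v1 t ≠ 0)
    (y : ℕ → ℝ) (hy0 : y 0 = 0)
    (hy : ∀ t, 1 ≤ t → t ≤ T →
      y t = (if 0 < v0 t then (1 : ℝ) else 0) * (1 - y (t - 1))
            + (if 0 < v1 t then (1 : ℝ) else 0) * y (t - 1))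
    (ys : ℝ → ℕ → ℝ) (hys0 : ∀ lam : ℝ, 0 < lam → ys lam 0 = 0)
    (hys : ∀ lam : ℝ, 0 < lam → ∀ t, 1 ≤ t → t ≤ T →
      ys lam t = K (v0 t / lam) * (1 - ys lam (t - 1)) + K (v1 t / lam) * ys lam (t - 1)) :
    ∀ t ≤ T, Filter.Tendsto (fun lam : ℝ => ys lam t) (𝓝[>] (0 : ℝ)) (𝓝 (y t)) := by
  intro t
  induction t with
  | zero =>
    intro _
    rw [hy0]
    refine tendsto_const_nhds.congr' ?_
    filter_upwards [self_mem_nhdsWithin] with lam hlam using (hys0 lam hlam).symm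
  | succ t ih =>
    intro ht
    have hprev := ih (Nat.le_of_succ_le ht)
    have hpos : 1 ≤ t + 1 := Nat.le_add_left 1 t
    rw [hy (t + 1) hpos ht]
    refine Tendsto.congr' ?_
      (((tendsto_comp_div_nhdsGT_zero hK0 hK1 (hv0 _ hpos ht)).mul (hprev.const_sub 1)).add
        ((tendsto_comp_div_nhdsGT_zero hK0 hK1 (hv1 _ hpos ht)).mul hprev))
    filter_upwards [self_mem_nhdsWithin] with lam hlam using (hys lam hlam _ hpos ht).symm
end

section
/- Let (Ω, F, P) be a probability space and G ⊆ F a sub-σ-algebra. Let η : Ω → ℝ be a random variable that is independent of G and whose law has a density f with respect to Lebesgue measure, and let V : Ω → ℝ be G-measurable. Let q ∈ ℕ, b ∈ ℝ with b ≠ 0, λ > 0, and M ≥ 0 with |u|^q f(u) ≤ M for all u ∈ ℝ, and let L : ℝ → ℝ be Borel measurable with ∫_ℝ L(w)² dw < ∞. Then the random variable |η|^q · L((V + b η)/λ)² is integrable, and its conditional expectation given G satisfies, P-almost surely, E[ |η|^q · L((V + b η)/λ)² | G ] ≤ (λ/|b|) · M · ∫_ℝ L(w)² dw. -/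
open MeasureTheory ProbabilityTheory

/-- If `X` and `Y` are independent and the integral of `h (x, ·)` against the law of `Y` is at most
`C` for every `x`, then the integral of `h (X, Y)` over the event `X ∈ s` is at most `C` times the
probability of that event. -/
lemma setLIntegral_comp_prodMk_le_of_indepFun {Ω β γ : Type*} {mΩ : MeasurableSpace Ω}
    {mβ : MeasurableSpace β} {mγ : MeasurableSpace γ} {P : Measure Ω} [IsFiniteMeasure P]
    {X : Ω → β} {Y : Ω → γ} (hX : Measurable X) (hY : Measurable Y) (hXY : IndepFun X Y P)
    {h : β × γ → ENNReal} (hh : Measurable h) {C : ENNReal}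
    (hC : ∀ x, ∫⁻ y, h (x, y) ∂(P.map Y) ≤ C) {s : Set β} (hs : MeasurableSet s) :
    ∫⁻ ω in X ⁻¹' s, h (X ω, Y ω) ∂P ≤ C * P (X ⁻¹' s) := by
  have hprod := (indepFun_iff_map_prod_eq_prod_map_map hX.aemeasurable hY.aemeasurable).1 hXY
  have hind : Measurable ((s ×ˢ Set.univ).indicator h) := hh.indicator (hs.prod .univ)
  calc ∫⁻ ω in X ⁻¹' s, h (X ω, Y ω) ∂P
      = ∫⁻ ω, (s ×ˢ Set.univ).indicator h (X ω, Y ω) ∂P := by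
        rw [← lintegral_indicator (hX hs)]
        refine lintegral_congr fun ω => ?_
        by_cases hω : X ω ∈ s <;> simp [Set.indicator, hω]
    _ = ∫⁻ z, (s ×ˢ Set.univ).indicator h z ∂((P.map X).prod (P.map Y)) := by
        rw [← hprod, lintegral_map hind (hX.prodMk hY)]
    _ = ∫⁻ x, ∫⁻ y, (s ×ˢ Set.univ).indicator h (x, y) ∂(P.map Y) ∂(P.map X) :=
        lintegral_prod _ hind.aemeasurable
    _ ≤ ∫⁻ x, s.indicator (fun _ => C) x ∂(P.map X) := by
        refine lintegral_mono fun x => ?_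
        by_cases hx : x ∈ s
        · simpa [Set.indicator, hx] using hC x
        · simp [Set.indicator, hx]
    _ = C * P (X ⁻¹' s) := by
        rw [lintegral_indicator_const hs, Measure.map_apply hX hs]

/-- A measurable nonnegative function whose lower integral over every `m`-measurable set `s` is at
most `C * P s` is integrable, and its conditional expectation given `m` is at most `C`. -/
lemma integrable_and_condExp_le_of_setLIntegral_le {Ω : Type*} {m mΩ : MeasurableSpace Ω}
    {P : Measure Ω} [IsFiniteMeasure P] (hm : m ≤ mΩ) {g : Ω → ℝ} (hg : Measurable g)
    (hg0 : ∀ ω, 0 ≤ g ω) {C : ℝ} (hC0 : 0 ≤ C)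
    (hC : ∀ s, MeasurableSet[m] s →
      ∫⁻ ω in s, ENNReal.ofReal (g ω) ∂P ≤ ENNReal.ofReal C * P s) :
    Integrable g P ∧ P[g|m] ≤ᵐ[P] fun _ => C := by
  have hint : Integrable g P := by
    refine ⟨hg.aestronglyMeasurable, ?_⟩
    rw [hasFiniteIntegral_iff_ofReal (.of_forall hg0)]
    have huniv := hC Set.univ MeasurableSet.univ
    rw [Measure.restrict_univ] at huniv
    exact huniv.trans_lt (ENNReal.mul_lt_top ENNReal.ofReal_lt_top (measure_lt_top _ _))
  refine ⟨hint, ae_le_of_ae_le_trim (hm := hm) ?_⟩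
  refine ae_le_of_forall_setIntegral_le
    (integrable_condExp.trim hm stronglyMeasurable_condExp) (integrable_const C) fun s hs _ => ?_
  rw [← setIntegral_trim hm stronglyMeasurable_condExp hs,
    ← setIntegral_trim hm stronglyMeasurable_const hs, setIntegral_condExp hm hint hs,
    setIntegral_const, smul_eq_mul,
    integral_eq_lintegral_of_nonneg_ae (.of_forall hg0) hg.aestronglyMeasurable]
  refine (ENNReal.toReal_mono (by finiteness) (hC s hs)).trans_eq ?_
  rw [ENNReal.toReal_mul, ENNReal.toReal_ofReal hC0, mul_comm, measureReal_def]

/-- If a density `f` satisfies `|u| ^ q * f u ≤ M`, then the `q`-th absolute moment of the law,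
weighted by the rescaled kernel `K ((v + b * u) / lam)`, is at most `lam / |b| * M * ∫ K`. -/
lemma lintegral_abs_pow_mul_comp_le {f : ℝ → ℝ} (hf : Measurable f)
    {q : ℕ} {b lam M : ℝ} (hb : b ≠ 0) (hlam : 0 < lam)
    (hf_bound : ∀ u, |u| ^ q * f u ≤ M) {K : ℝ → ℝ} (hK : Measurable K) (hK0 : ∀ w, 0 ≤ K w)
    (hK_int : Integrable K) (hM : 0 ≤ M) (v : ℝ) :
    ∫⁻ u, ENNReal.ofReal (|u| ^ q * K ((v + b * u) / lam))
        ∂(volume.withDensity fun u => ENNReal.ofReal (f u))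
      ≤ ENNReal.ofReal (lam / |b| * M * ∫ w, K w) := by
  have hr : b / lam ≠ 0 := div_ne_zero hb hlam.ne'
  have haff : (fun u => K ((v + b * u) / lam)) = fun u => K (b / lam * u + v / lam) := by
    ext u; congr 1; ring
  have hint : Integrable fun u => K ((v + b * u) / lam) := by
    rw [haff]
    exact (hK_int.comp_add_right (v / lam)).comp_mul_left' hr
  have heq : ∫ u, K ((v + b * u) / lam) = lam / |b| * ∫ w, K w := by
    rw [haff, Measure.integral_comp_mul_left (fun u => K (u + v / lam)),
      integral_add_right_eq_self, smul_eq_mul, inv_div, abs_div, abs_of_pos hlam]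
  rw [lintegral_withDensity_eq_lintegral_mul _ (by fun_prop) (by fun_prop)]
  calc ∫⁻ u, ENNReal.ofReal (f u) * ENNReal.ofReal (|u| ^ q * K ((v + b * u) / lam))
      ≤ ∫⁻ u, ENNReal.ofReal (M * K ((v + b * u) / lam)) := by
        refine lintegral_mono fun u => ?_
        rw [← ENNReal.ofReal_mul' (mul_nonneg (by positivity) (hK0 _))]
        refine ENNReal.ofReal_le_ofReal ?_
        calc f u * (|u| ^ q * K ((v + b * u) / lam))
            = |u| ^ q * f u * K ((v + b * u) / lam) := by ring
          _ ≤ M * K ((v + b * u) / lam) := mul_le_mul_of_nonneg_right (hf_bound u) (hK0 _)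
    _ = ENNReal.ofReal (lam / |b| * M * ∫ w, K w) := by
        rw [← ofReal_integral_eq_lintegral_ofReal (hint.const_mul M)
          (.of_forall fun u => mul_nonneg hM (hK0 _)), integral_const_mul, heq]
        congr 1
        ring

/-- Conditional second-moment bound: if `η` is independent of the sub-σ-algebra `G`, has a
density `f` with `|u|^q f(u) ≤ M`, `V` is `G`-measurable, and `∫ L² < ∞`, then
`|η|^q · L((V + bη)/λ)²` is integrable and its conditional expectation given `G` is
almost surely at most `(λ/|b|) · M · ∫ L(w)² dw`. -/
theorem conditional_kernel_moment_bound
    {Ω : Type*} (G : MeasurableSpace Ω) [mΩ : MeasurableSpace Ω]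
    {P : Measure Ω} [IsProbabilityMeasure P] (hG : G ≤ mΩ)
    (η : Ω → ℝ) (hη_meas : Measurable η)
    (h_indep : Indep (MeasurableSpace.comap η (borel ℝ)) G P)
    (f : ℝ → ℝ) (hf_meas : Measurable f) (hf_nonneg : ∀ u, 0 ≤ f u)
    (h_law : Measure.map η P = MeasureTheory.volume.withDensity fun u => ENNReal.ofReal (f u))
    (V : Ω → ℝ) (hV : Measurable[G] V)
    (q : ℕ) (b lam M : ℝ) (hb : b ≠ 0) (hlam : 0 < lam) (hM : 0 ≤ M)
    (hf_bound : ∀ u, |u| ^ q * f u ≤ M)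
    (L : ℝ → ℝ) (hL_meas : Measurable L) (hL2 : Integrable (fun w => L w ^ 2)) :
    Integrable (fun ω => |η ω| ^ q * L ((V ω + b * η ω) / lam) ^ 2) P ∧
      ∀ᵐ ω ∂P,
        (P[fun ω => |η ω| ^ q * L ((V ω + b * η ω) / lam) ^ 2|G]) ω
          ≤ (lam / |b|) * M * ∫ w : ℝ, L w ^ 2 := by
  have hV' : Measurable V := hV.mono hG le_rfl
  have hindep : @IndepFun Ω Ω ℝ mΩ G _ id η P := by
    have h := h_indep.symm
    rw [← BorelSpace.measurable_eq (α := ℝ)] at h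
    rwa [@IndepFun_iff_Indep, MeasurableSpace.comap_id]
  refine integrable_and_condExp_le_of_setLIntegral_le hG (by fun_prop) (fun ω => by positivity)
    (mul_nonneg (by positivity) (integral_nonneg fun w => sq_nonneg _)) fun s hs => ?_
  have hmeas : @Measurable (Ω × ℝ) ENNReal (@Prod.instMeasurableSpace Ω ℝ G _) _
      fun p => ENNReal.ofReal (|p.2| ^ q * L ((V p.1 + b * p.2) / lam) ^ 2) := by
    have hpair : @Measurable (Ω × ℝ) (ℝ × ℝ) (@Prod.instMeasurableSpace Ω ℝ G _) _
        fun p => (V p.1, p.2) :=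
      (hV.comp (@measurable_fst Ω ℝ G _)).prodMk (@measurable_snd Ω ℝ G _)
    have hreal : Measurable fun z : ℝ × ℝ =>
        ENNReal.ofReal (|z.2| ^ q * L ((z.1 + b * z.2) / lam) ^ 2) := by fun_prop
    exact hreal.comp hpair
  refine setLIntegral_comp_prodMk_le_of_indepFun (mβ := G) (X := id) (measurable_id'' hG)
    hη_meas hindep hmeas (fun ω => ?_) hs
  rw [h_law]
  exact lintegral_abs_pow_mul_comp_le hf_meas hb hlam hf_bound (hL_meas.pow_const 2)
    (fun w => sq_nonneg _) hL2 hM (V ω)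
end
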